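/- Let K be a field. The kernel of the K-algebra homomorphism K[T₁,T₂,T₃,T₄] → K[t,s] determined by T₁ ↦ t⁴, T₂ ↦ t³s, T₃ ↦ ts³, T₄ ↦ s⁴ equals the ideal j = (T₁²T₃ − T₂³, T₁T₄ − T₂T₃, T₁T₃² − T₂²T₄, T₂T₄² − T₃³). In particular, j is a prime ideal of K[T₁,T₂,T₃,T₄]. -/

import Mathlib

open MvPolynomial

/-- The parametrization map `K[T₁,T₂,T₃,T₄] → K[t,s]`,
`T₁ ↦ t⁴, T₂ ↦ t³s, T₃ ↦ ts³, T₄ ↦ s⁴` of the rational quartic space curve. -/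
noncomputable def quarticParam (K : Type*) [Field K] :
    MvPolynomial (Fin 4) K →ₐ[K] MvPolynomial (Fin 2) K :=
  aeval ![X 0 ^ 4, X 0 ^ 3 * X 1, X 0 * X 1 ^ 3, X 1 ^ 4]

/-- The ideal of the rational quartic space curve
`(x₁ : x₂ : x₃ : x₄) = (t⁴ : t³s : ts³ : s⁴)`. -/
noncomputable def quarticIdeal (K : Type*) [Field K] : Ideal (MvPolynomial (Fin 4) K) :=
  Ideal.span {X 0 ^ 2 * X 2 - X 1 ^ 3, X 0 * X 3 - X 1 * X 2,
    X 0 * X 2 ^ 2 - X 1 ^ 2 * X 3, X 1 * X 3 ^ 2 - X 2 ^ 3}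

/-- Modulo the four quartic relations, every monomial equals a reduced one of the same bidegree. -/
lemma exists_reduced_monomial {R : Type*} [CommRing R] {x y z w : R}
    (h₁ : x ^ 2 * z = y ^ 3) (h₂ : x * w = y * z) (h₃ : x * z ^ 2 = y ^ 2 * w)
    (h₄ : y * w ^ 2 = z ^ 3) (a b c d : ℕ) :
    ∃ a' b' c' d' : ℕ, 4 * a + 3 * b + c = 4 * a' + 3 * b' + c' ∧
      b + 3 * c + 4 * d = b' + 3 * c' + 4 * d' ∧
      x ^ a * y ^ b * z ^ c * w ^ d = x ^ a' * y ^ b' * z ^ c' * w ^ d' ∧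
      (b' = 0 ∨ c' = 0) ∧ b' < 3 ∧ c' < 3 ∧ (b' < 2 ∨ d' = 0) := by
  induction hn : 3 * b + 2 * c using Nat.strong_induction_on generalizing a b c d with
  | _ n ih =>
    by_cases hyz : 1 ≤ b ∧ 1 ≤ c
    · obtain ⟨⟨b, rfl⟩, ⟨c, rfl⟩⟩ := hyz.imp Nat.exists_eq_add_of_le' Nat.exists_eq_add_of_le'
      obtain ⟨a', b', c', d', e₁, e₂, e, hr⟩ := ih _ (by omega) (a + 1) b c (d + 1) rfl
      refine ⟨a', b', c', d', by omega, by omega, e ▸ ?_, hr⟩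
      linear_combination -(x ^ a * y ^ b * z ^ c * w ^ d) * h₂
    by_cases hy : 3 ≤ b
    · obtain ⟨b, rfl⟩ := Nat.exists_eq_add_of_le' hy
      obtain ⟨a', b', c', d', e₁, e₂, e, hr⟩ := ih _ (by omega) (a + 2) b (c + 1) d rfl
      refine ⟨a', b', c', d', by omega, by omega, e ▸ ?_, hr⟩
      linear_combination -(x ^ a * y ^ b * z ^ c * w ^ d) * h₁
    by_cases hz : 3 ≤ c
    · obtain ⟨c, rfl⟩ := Nat.exists_eq_add_of_le' hz
      obtain ⟨a', b', c', d', e₁, e₂, e, hr⟩ := ih _ (by omega) a (b + 1) c (d + 2) rfl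
      refine ⟨a', b', c', d', by omega, by omega, e ▸ ?_, hr⟩
      linear_combination -(x ^ a * y ^ b * z ^ c * w ^ d) * h₄
    by_cases hw : 2 ≤ b ∧ 1 ≤ d
    · obtain ⟨⟨b, rfl⟩, ⟨d, rfl⟩⟩ := hw.imp Nat.exists_eq_add_of_le' Nat.exists_eq_add_of_le'
      obtain ⟨a', b', c', d', e₁, e₂, e, hr⟩ := ih _ (by omega) (a + 1) b (c + 2) d rfl
      refine ⟨a', b', c', d', by omega, by omega, e ▸ ?_, hr⟩
      linear_combination -(x ^ a * y ^ b * z ^ c * w ^ d) * h₃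
    exact ⟨a, b, c, d, rfl, rfl, rfl, by omega, by omega, by omega, by omega⟩

/-- Modulo the four quartic relations, monomials of the same bidegree are equal. -/
lemma monomial_eq_of_bidegree_eq {R : Type*} [CommRing R] {x y z w : R}
    (h₁ : x ^ 2 * z = y ^ 3) (h₂ : x * w = y * z) (h₃ : x * z ^ 2 = y ^ 2 * w)
    (h₄ : y * w ^ 2 = z ^ 3) {a b c d a' b' c' d' : ℕ}
    (ht : 4 * a + 3 * b + c = 4 * a' + 3 * b' + c')
    (hs : b + 3 * c + 4 * d = b' + 3 * c' + 4 * d') :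
    x ^ a * y ^ b * z ^ c * w ^ d = x ^ a' * y ^ b' * z ^ c' * w ^ d' := by
  obtain ⟨a₁, b₁, c₁, d₁, t₁, s₁, e₁, r₁⟩ := exists_reduced_monomial h₁ h₂ h₃ h₄ a b c d
  obtain ⟨a₂, b₂, c₂, d₂, t₂, s₂, e₂, r₂⟩ := exists_reduced_monomial h₁ h₂ h₃ h₄ a' b' c' d'
  have hb : b₁ = b₂ := by
    obtain ⟨_, hb₁, _⟩ := r₁
    obtain ⟨_, hb₂, _⟩ := r₂
    interval_cases b₁ <;> interval_cases b₂ <;> omega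
  have hc : c₁ = c₂ := by omega
  obtain rfl : a₁ = a₂ := by omega
  obtain rfl : d₁ = d₂ := by omega
  rw [e₁, e₂, hb, hc]

/-- The exponent of the image of a monomial under `quarticParam`. -/
noncomputable def quarticExponent (m : Fin 4 →₀ ℕ) : Fin 2 →₀ ℕ :=
  Finsupp.single 0 (4 * m 0 + 3 * m 1 + m 2) + Finsupp.single 1 (m 1 + 3 * m 2 + 4 * m 3)

lemma quarticParam_monomial_one (K : Type*) [Field K] (m : Fin 4 →₀ ℕ) :
    quarticParam K (monomial m 1) = monomial (quarticExponent m) 1 := by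
  have h : (monomial (quarticExponent m) 1 : MvPolynomial (Fin 2) K) =
      X 0 ^ (4 * m 0 + 3 * m 1 + m 2) * X 1 ^ (m 1 + 3 * m 2 + 4 * m 3) := by
    simp [quarticExponent, X_pow_eq_monomial, monomial_mul]
  rw [h, quarticParam, aeval_monomial, Finsupp.prod_fintype _ _ (by simp)]
  simp [Fin.prod_univ_four]
  ring

lemma quarticIdeal_le_ker (K : Type*) [Field K] :
    quarticIdeal K ≤ RingHom.ker (quarticParam K) := by
  rw [quarticIdeal, Ideal.span_le]
  rintro p (rfl | rfl | rfl | rfl) <;>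
  · simp [RingHom.mem_ker, quarticParam]
    ring

lemma mk_monomial_eq_of_quarticExponent_eq (K : Type*) [Field K] {m m' : Fin 4 →₀ ℕ}
    (h : quarticExponent m = quarticExponent m') :
    Ideal.Quotient.mk (quarticIdeal K) (monomial m 1) =
      Ideal.Quotient.mk (quarticIdeal K) (monomial m' 1) := by
  have ht := DFunLike.congr_fun h 0
  have hs := DFunLike.congr_fun h 1
  simp only [quarticExponent, Finsupp.add_apply, Finsupp.single_apply] at ht hs
  simp only [monomial_eq, map_one, one_mul, Finsupp.prod_fintype _ _ (fun _ => pow_zero _),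
    Fin.prod_univ_four, map_mul, map_pow]
  apply monomial_eq_of_bidegree_eq _ _ _ _ (by simpa using ht) (by simpa using hs)
  all_goals
    simp only [← map_mul, ← map_pow]
    exact Ideal.Quotient.eq.mpr (Ideal.subset_span (by simp))

lemma ker_quarticParam (K : Type*) [Field K] :
    RingHom.ker (quarticParam K) = quarticIdeal K := by
  refine le_antisymm (fun p hp => ?_) (quarticIdeal_le_ker K)
  let q := (Ideal.Quotient.mkₐ K (quarticIdeal K)).toLinearMap
  let g : MvPolynomial (Fin 2) K →ₗ[K] MvPolynomial (Fin 4) K ⧸ quarticIdeal K :=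
    (basisMonomials (Fin 2) K).constr K
      fun n => q (monomial (Function.invFun quarticExponent n) 1)
  have hg : g ∘ₗ (quarticParam K).toLinearMap = q := by
    refine (basisMonomials (Fin 4) K).ext fun m => ?_
    have hm : g (monomial (quarticExponent m) 1) =
        q (monomial (Function.invFun quarticExponent (quarticExponent m)) 1) := by
      simpa using (basisMonomials (Fin 2) K).constr_basis K
        (fun n => q (monomial (Function.invFun quarticExponent n) 1)) (quarticExponent m)
    rw [coe_basisMonomials, LinearMap.comp_apply, AlgHom.toLinearMap_apply,
      quarticParam_monomial_one, hm]
    exact mk_monomial_eq_of_quarticExponent_eq K (Function.invFun_eq ⟨m, rfl⟩)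
  rw [← Ideal.Quotient.eq_zero_iff_mem]
  change q p = 0
  rw [← hg, LinearMap.comp_apply, AlgHom.toLinearMap_apply, RingHom.mem_ker.mp hp, map_zero]

/-- The kernel of the parametrization of the rational quartic space curve is the ideal
`j = (T₁²T₃ − T₂³, T₁T₄ − T₂T₃, T₁T₃² − T₂²T₄, T₂T₄² − T₃³)`; in particular `j` is prime. -/
theorem quartic_ideal_eq_ker (K : Type*) [Field K] :
    RingHom.ker (quarticParam K) = quarticIdeal K ∧ (quarticIdeal K).IsPrime := by
  exact ⟨ker_quarticParam K, ker_quarticParam K ▸ RingHom.ker_isPrime _⟩
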